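/- arXiv:1605.02581 — 2 statements merged into one kernel-verified Lean document; each statement's English description precedes it below -/
import Mathlib

section
/- Let v, b be continuous non-negative functions on ℝ with b ∈ L^1(ℝ) and v ∈ L^∞((r,∞)) for every real r. Let a : ℝ → (0,∞) be a continuous bounded function such that a(x) = C > 0 for x ≤ 0 and a is decreasing on [0,∞). If v(x) ≤ a(x) + ∫_x^∞ b(t) v(t) dt for all x ∈ ℝ, then there is a constant K depending only on ∫_ℝ b(t) dt such that v(x) ≤ K a(x₊) for all x ∈ ℝ, where x₊ = max(0,x). -/
open MeasureTheory

/-- Gronwall's inequality on a half-line, with constant forcing term `A`. -/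
theorem gronwall_Ioi_const {v b : ℝ → ℝ} {A x₀ : ℝ} (hv : Continuous v) (hb : Continuous b)
    (hb0 : ∀ x, 0 ≤ b x) (hbi : IntegrableOn b (Set.Ioi x₀))
    (hbvi : IntegrableOn (fun t => b t * v t) (Set.Ioi x₀))
    (h : ∀ x, x₀ ≤ x → v x ≤ A + ∫ t in Set.Ioi x, b t * v t) :
    v x₀ ≤ A * Real.exp (∫ t in Set.Ioi x₀, b t) := by
  have hbv : Continuous fun t => b t * v t := hb.mul hv
  set J := ∫ t in Set.Ioi x₀, b t * v t with hJ
  let G : ℝ → ℝ := fun x =>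
    (A + (J - ∫ t in x₀..x, b t * v t)) * Real.exp (∫ t in x₀..x, b t)
  have hG : ∀ x, HasDerivAt G
      (-(b x * v x) * Real.exp (∫ t in x₀..x, b t) +
        (A + (J - ∫ t in x₀..x, b t * v t)) * (Real.exp (∫ t in x₀..x, b t) * b x)) x := by
    intro x
    have h1 := ((hbv.integral_hasStrictDerivAt x₀ x).hasDerivAt.const_sub J).const_add A
    have h2 := (hb.integral_hasStrictDerivAt x₀ x).hasDerivAt.exp
    exact h1.mul h2
  have htail : ∀ x, x₀ ≤ x → ∫ t in Set.Ioi x, b t * v t = J - ∫ t in x₀..x, b t * v t := by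
    intro x hx
    have := intervalIntegral.integral_interval_add_Ioi hbvi
      (hbvi.mono_set (Set.Ioi_subset_Ioi hx))
    linarith
  have hmono : MonotoneOn G (Set.Ici x₀) := by
    refine monotoneOn_of_deriv_nonneg (convex_Ici x₀)
      (fun x _ => (hG x).continuousAt.continuousWithinAt)
      (fun x _ => (hG x).differentiableAt.differentiableWithinAt) fun x hx => ?_
    rw [interior_Ici] at hx
    have hvx := h x (le_of_lt hx)
    rw [htail x (le_of_lt hx)] at hvx
    rw [(hG x).deriv]
    have := mul_nonneg (mul_nonneg (hb0 x) (sub_nonneg.2 hvx))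
      (Real.exp_pos (∫ t in x₀..x, b t)).le
    linarith
  have hlim : Filter.Tendsto G Filter.atTop
      (nhds ((A + (J - J)) * Real.exp (∫ t in Set.Ioi x₀, b t))) := by
    have h1 := intervalIntegral_tendsto_integral_Ioi x₀ hbvi Filter.tendsto_id
    have h2 := intervalIntegral_tendsto_integral_Ioi x₀ hbi Filter.tendsto_id
    exact ((h1.const_sub J).const_add A).mul ((Real.continuous_exp.tendsto _).comp h2)
  have hle := ge_of_tendsto hlim ((Filter.eventually_ge_atTop x₀).mono fun x hx =>
    hmono (Set.mem_Ici.2 le_rfl) hx hx)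
  simp only [G, intervalIntegral.integral_same, sub_zero, Real.exp_zero, mul_one, sub_self,
    add_zero] at hle
  exact (h x₀ le_rfl).trans hle

/-- Corollary of Gronwall's lemma on the real line: with `a` positive, bounded, constant equal
to `C` on `(-∞,0]` and decreasing on `[0,∞)`, the integral inequality
`v(x) ≤ a(x) + ∫_x^∞ b v` implies `v(x) ≤ K a(x₊)` where `K` depends only on `∫_ℝ b`. -/
theorem gronwall_corollary :
    ∃ K : ℝ → ℝ, ∀ (v b a : ℝ → ℝ) (C : ℝ),
      Continuous v → Continuous b →
      (∀ x, 0 ≤ v x) → (∀ x, 0 ≤ b x) →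
      Integrable b →
      (∀ r : ℝ, BddAbove (v '' Set.Ioi r)) →
      Continuous a → (∀ x, 0 < a x) → BddAbove (Set.range a) →
      0 < C → (∀ x ≤ (0 : ℝ), a x = C) → AntitoneOn a (Set.Ici 0) →
      (∀ x, v x ≤ a x + ∫ t in Set.Ioi x, b t * v t) →
      ∀ x, v x ≤ K (∫ t : ℝ, b t) * a (max 0 x) := by
  refine ⟨Real.exp, fun v b a C hv hb hv0 hb0 hbi hvb _ ha0 _ _ haC hanti h x => ?_⟩
  have ha_max : ∀ y, a y = a (max 0 y) := by
    intro y
    rcases le_total y 0 with hy | hy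
    · rw [max_eq_left hy, haC y hy, haC 0 le_rfl]
    · rw [max_eq_right hy]
  have ha : ∀ y, x ≤ y → a y ≤ a (max 0 x) := fun y hy => by
    rw [ha_max y]
    exact hanti (le_max_left 0 x) (le_max_left 0 y) (max_le_max le_rfl hy)
  obtain ⟨M, hM⟩ := hvb x
  have hbvi : IntegrableOn (fun t => b t * v t) (Set.Ioi x) := by
    refine (hbi.integrableOn.mul_const M).mono' (hb.mul hv).aestronglyMeasurable ?_
    filter_upwards [ae_restrict_mem measurableSet_Ioi] with t ht
    rw [Real.norm_of_nonneg (mul_nonneg (hb0 t) (hv0 t))]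
    exact mul_le_mul_of_nonneg_left (hM (Set.mem_image_of_mem v ht)) (hb0 t)
  have hvx := gronwall_Ioi_const hv hb hb0 hbi.integrableOn hbvi fun y hy =>
    (h y).trans (add_le_add_left (ha y hy) _)
  have hB : ∫ t in Set.Ioi x, b t ≤ ∫ t, b t :=
    setIntegral_le_integral hbi (Filter.Eventually.of_forall hb0)
  rw [mul_comm]
  exact hvx.trans (mul_le_mul_of_nonneg_left (Real.exp_le_exp.2 hB) (ha0 _).le)
end

section
/- Let σ ∈ [0,1] and define D(t,τ) = (e^{2itτ} − 1)/(2iτ) for τ ≠ 0 and D(t,0) = t (so that D(t,τ) = ∫_0^t e^{2iyτ} dy). Then there exists a constant C depending only on σ such that for all t ∈ ℝ and all τ₁, τ₂ ∈ ℝ: |τ₁ D(t,τ₁) − τ₂ D(t,τ₂)| ≤ C ⟨t⟩^σ |τ₁ − τ₂|^σ and |D(t,τ₁) − D(t,τ₂)| ≤ C ⟨t⟩^{1+σ} |τ₁ − τ₂|^σ. -/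
/-- The Japanese bracket `⟨t⟩ = (1+t²)^{1/2}`. -/
noncomputable def jap (x : ℝ) : ℝ := Real.sqrt (1 + x ^ 2)

/-- The kernel of the Marchenko integral equation:
`D(t,τ) = (e^{2itτ} − 1)/(2iτ)` for `τ ≠ 0` and `D(t,0) = t`. -/
noncomputable def MarchenkoD (t τ : ℝ) : ℂ :=
  if τ = 0 then (t : ℂ)
  else (Complex.exp (2 * Complex.I * t * τ) - 1) / (2 * Complex.I * τ)

theorem MarchenkoD_eq_integral (t τ : ℝ) :
    MarchenkoD t τ = ∫ y in (0 : ℝ)..t, Complex.exp (2 * Complex.I * τ * y) := by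
  unfold MarchenkoD
  split_ifs with h
  · simp [h]
  · have hc : (2 * Complex.I * τ : ℂ) ≠ 0 := by
      simp [h]
    rw [integral_exp_mul_complex hc]
    simp [mul_right_comm]

theorem mul_MarchenkoD (t τ : ℝ) :
    (τ : ℂ) * MarchenkoD t τ = (Complex.exp (2 * Complex.I * t * τ) - 1) / (2 * Complex.I) := by
  unfold MarchenkoD
  split_ifs with h
  · simp [h]
  · have hc : (τ : ℂ) ≠ 0 := by exact_mod_cast h
    field_simp

theorem norm_exp_two_I_mul (y τ : ℝ) : ‖Complex.exp (2 * Complex.I * y * τ)‖ = 1 := by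
  have h : (2 * Complex.I * y * τ : ℂ) = ((2 * y * τ : ℝ) : ℂ) * Complex.I := by
    push_cast; ring
  rw [h, Complex.norm_exp_ofReal_mul_I]

theorem norm_exp_sub_exp_le (y τ₁ τ₂ : ℝ) :
    ‖Complex.exp (2 * Complex.I * y * τ₁) - Complex.exp (2 * Complex.I * y * τ₂)‖ ≤
      2 * |y| * |τ₁ - τ₂| := by
  have h : Complex.exp (2 * Complex.I * y * τ₁) - Complex.exp (2 * Complex.I * y * τ₂) =
      Complex.exp (2 * Complex.I * y * τ₂) *
        (Complex.exp (Complex.I * ((2 * y * (τ₁ - τ₂) : ℝ) : ℂ)) - 1) := by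
    rw [mul_sub, ← Complex.exp_add, mul_one]
    congr 2
    push_cast; ring
  rw [h, norm_mul, norm_exp_two_I_mul, one_mul]
  refine (Real.norm_exp_I_mul_ofReal_sub_one_le).trans_eq ?_
  simp

theorem norm_exp_sub_exp_le_two (y τ₁ τ₂ : ℝ) :
    ‖Complex.exp (2 * Complex.I * y * τ₁) - Complex.exp (2 * Complex.I * y * τ₂)‖ ≤ 2 := by
  refine (norm_sub_le _ _).trans ?_
  rw [norm_exp_two_I_mul, norm_exp_two_I_mul]
  norm_num

theorem norm_MarchenkoD_sub_le {t τ₁ τ₂ M : ℝ}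
    (hM : ∀ y : ℝ, |y| ≤ |t| →
      ‖Complex.exp (2 * Complex.I * y * τ₁) - Complex.exp (2 * Complex.I * y * τ₂)‖ ≤ M) :
    ‖MarchenkoD t τ₁ - MarchenkoD t τ₂‖ ≤ M * |t| := by
  rw [MarchenkoD_eq_integral, MarchenkoD_eq_integral, ← intervalIntegral.integral_sub
    (Continuous.intervalIntegrable (by fun_prop) _ _)
    (Continuous.intervalIntegrable (by fun_prop) _ _)]
  refine (intervalIntegral.norm_integral_le_of_norm_le_const (C := M) fun y hy => ?_).trans_eq
    (by simp)
  rw [mul_right_comm _ (τ₁ : ℂ), mul_right_comm _ (τ₂ : ℂ)]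
  refine hM y ?_
  simpa using Set.abs_sub_left_of_mem_uIcc (Set.uIoc_subset_uIcc hy)

theorem abs_le_jap (t : ℝ) : |t| ≤ jap t :=
  Real.abs_le_sqrt (by linarith)

theorem jap_pos (t : ℝ) : 0 < jap t :=
  Real.sqrt_pos.mpr (by positivity)

/-- Interpolation between the trivial bound and the linear bound. -/
theorem le_mul_rpow_of_le_of_le_mul {x a u σ : ℝ} (ha : 0 ≤ a) (hu : 0 ≤ u) (hσ0 : 0 ≤ σ)
    (hσ1 : σ ≤ 1) (h₁ : x ≤ a) (h₂ : x ≤ a * u) : x ≤ a * u ^ σ := by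
  rcases le_total u 1 with h | h
  · exact h₂.trans (mul_le_mul_of_nonneg_left (Real.self_le_rpow_of_le_one hu h hσ1) ha)
  · exact h₁.trans (le_mul_of_one_le_right ha (Real.one_le_rpow h hσ0))

/-- Hölder-in-`τ` bounds for the Marchenko kernel: for `σ ∈ [0,1]`,
`|τ₁D(t,τ₁) − τ₂D(t,τ₂)| ≤ C ⟨t⟩^σ |τ₁−τ₂|^σ` and
`|D(t,τ₁) − D(t,τ₂)| ≤ C ⟨t⟩^{1+σ} |τ₁−τ₂|^σ`. -/
theorem marchenko_kernel_holder_bounds (σ : ℝ) (hσ0 : 0 ≤ σ) (hσ1 : σ ≤ 1) :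
    ∃ C : ℝ, ∀ t τ₁ τ₂ : ℝ,
      ‖(τ₁ : ℂ) * MarchenkoD t τ₁ - (τ₂ : ℂ) * MarchenkoD t τ₂‖ ≤
        C * jap t ^ σ * |τ₁ - τ₂| ^ σ ∧
      ‖MarchenkoD t τ₁ - MarchenkoD t τ₂‖ ≤
        C * jap t ^ (1 + σ) * |τ₁ - τ₂| ^ σ := by
  refine ⟨2, fun t τ₁ τ₂ => ?_⟩
  have hJ := jap_pos t
  have htJ := abs_le_jap t
  have hd : 0 ≤ |τ₁ - τ₂| := abs_nonneg _
  have hlin : ∀ y : ℝ, |y| ≤ |t| →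
      ‖Complex.exp (2 * Complex.I * y * τ₁) - Complex.exp (2 * Complex.I * y * τ₂)‖ ≤
        2 * (jap t * |τ₁ - τ₂|) := fun y hy =>
    (norm_exp_sub_exp_le y τ₁ τ₂).trans <| by
      rw [mul_assoc]
      gcongr
      exact hy.trans htJ
  constructor
  · rw [mul_assoc, ← Real.mul_rpow hJ.le hd, mul_MarchenkoD, mul_MarchenkoD, ← sub_div,
      sub_sub_sub_cancel_right, norm_div]
    have h2 : ‖(2 * Complex.I : ℂ)‖ = 2 := by simp
    rw [h2]
    refine (half_le_self (norm_nonneg _)).trans ?_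
    exact le_mul_rpow_of_le_of_le_mul zero_le_two (by positivity) hσ0 hσ1
      (norm_exp_sub_exp_le_two t τ₁ τ₂) (hlin t le_rfl)
  · rw [Real.rpow_add hJ, Real.rpow_one, ← mul_assoc, mul_assoc (2 * jap t),
      ← Real.mul_rpow hJ.le hd]
    refine le_mul_rpow_of_le_of_le_mul (by positivity) (by positivity) hσ0 hσ1 ?_ ?_
    · refine (norm_MarchenkoD_sub_le fun y _ => norm_exp_sub_exp_le_two y τ₁ τ₂).trans ?_
      gcongr
    · refine (norm_MarchenkoD_sub_le hlin).trans ?_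
      rw [mul_right_comm]
      gcongr
end
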